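/- There exist unique elements ξ_I^+ ∈ V ⊗ ℂ[z_1,…,z_n,h][Ď^{−1}], indexed by I ∈ ℐ_λ, such that ξ^+_{I^{min}} = v_{I^{min}} and ξ^+_{s_i(I)} = ŝ̃_i^+ ξ^+_I for every I ∈ ℐ_λ and every i = 1,…,n−1. Moreover, ξ^+_I = Σ_{J ≤ I} X^+_{I,J} v_J with X^+_{I,J} ∈ ℂ[z_1,…,z_n,h][Ď^{−1}], X^+_{I,I} ≠ 0, and X^+_{I^{max},I^{max}} = R(z_{I^{max}})/Q(z_{I^{max}}). -/

import Mathlib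

open scoped BigOperators

noncomputable section

namespace GRTV

/-- The field `ℂ(z_1,…,z_n,h)` of rational functions. -/
abbrev K (n : ℕ) : Type := FractionRing (MvPolynomial (Fin n ⊕ Unit) ℂ)

/-- The variable `z_i`. -/
def z {n : ℕ} (i : Fin n) : K n :=
  algebraMap (MvPolynomial (Fin n ⊕ Unit) ℂ) (K n) (MvPolynomial.X (Sum.inl i))

/-- The variable `h`. -/
def hvar {n : ℕ} : K n :=
  algebraMap (MvPolynomial (Fin n ⊕ Unit) ℂ) (K n) (MvPolynomial.X (Sum.inr ()))

/-- The field automorphism of `ℂ(z_1,…,z_n,h)` permuting the variables `z_i` by `σ`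
(and fixing `h`); `f ↦ f^σ`. -/
def permK {n : ℕ} (σ : Equiv.Perm (Fin n)) : K n ≃+* K n :=
  IsFractionRing.ringEquivOfRingEquiv
    (MvPolynomial.renameEquiv ℂ (Equiv.sumCongr σ (Equiv.refl Unit))).toRingEquiv

/-- `V ⊗ ℂ(z_1,…,z_n,h)` in coordinates: a vector is the family of its coordinates
in the basis `{v_I}`, where a basis index (a decomposition `I`) is recorded as the word
`m : Fin n → Fin N` with `I_j = m⁻¹(j)`. -/
abbrev VV (n N : ℕ) : Type := (Fin n → Fin N) → K n

/-- `h` for the `+` case (`ε = true`) and `-h` for the `−` case (`ε = false`). -/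
def sign' {n : ℕ} (ε : Bool) : K n := if ε then hvar else -hvar

def fin1 {n : ℕ} (i : ℕ) (hi : i + 1 < n) : Fin n := ⟨i, Nat.lt_of_succ_lt hi⟩
def fin2 {n : ℕ} (i : ℕ) (hi : i + 1 < n) : Fin n := ⟨i + 1, hi⟩

/-- The operator `ŝ̃_i^±`:
`ŝ̃_i^± f = ((z_i−z_{i+1})P^{(i,i+1)} ∓ h)/(z_i−z_{i+1} ∓ h) · f^{s_i}`. -/
def tOp {n N : ℕ} (ε : Bool) (i : ℕ) (hi : i + 1 < n) (f : VV n N) : VV n N :=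
  fun m =>
    ((z (fin1 i hi) - z (fin2 i hi)) *
          permK (Equiv.swap (fin1 i hi) (fin2 i hi))
            (f (m ∘ ⇑(Equiv.swap (fin1 i hi) (fin2 i hi))))
        - sign' ε * permK (Equiv.swap (fin1 i hi) (fin2 i hi)) (f m))
      / (z (fin1 i hi) - z (fin2 i hi) - sign' ε)

/-- The block `I_a = {k : m k = a}` of the decomposition encoded by the word `m`. -/
def fib {n N : ℕ} (m : Fin n → Fin N) (a : Fin N) : Finset (Fin n) :=
  Finset.univ.filter (fun k => m k = a)

/-- `I ∈ ℐ_λ`, i.e. `|I_a| = λ_a` for all `a`. -/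
def memI {n N : ℕ} (lam : Fin N → ℕ) (m : Fin n → Fin N) : Prop :=
  ∀ a : Fin N, (fib m a).card = lam a

/-- The order on subsets of `{1,…,n}` of equal cardinality:
`A ≤ B` iff `a_j ≤ b_j` for all `j`, where `A = {a_1<⋯<a_m}`, `B = {b_1<⋯<b_m}`. -/
def subLE {n : ℕ} (A B : Finset (Fin n)) : Prop :=
  ∃ h : A.card = B.card,
    ∀ j : Fin A.card, (↑(A.orderIsoOfFin rfl j) : Fin n) ≤ ↑(B.orderIsoOfFin h.symm j)

/-- The strict order `I < J` on decompositions: `I_k = J_k` for `k < l` and `I_l < J_l`. -/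
def decLT {n N : ℕ} (mI mJ : Fin n → Fin N) : Prop :=
  ∃ l : Fin N, (∀ k : Fin N, k < l → fib mI k = fib mJ k) ∧
    subLE (fib mI l) (fib mJ l) ∧ fib mI l ≠ fib mJ l

/-- `I ≤ J` on decompositions. -/
def decLE {n N : ℕ} (mI mJ : Fin n → Fin N) : Prop :=
  decLT mI mJ ∨ mI = mJ

/-- `Q(z_I) = ∏_{1≤a<b≤N} ∏_{i∈I_a} ∏_{j∈I_b} (z_i−z_j+h)`. -/
def Qz {n N : ℕ} (m : Fin n → Fin N) : K n :=
  ∏ p ∈ Finset.univ.filter (fun p : Fin n × Fin n => m p.1 < m p.2),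
    (z p.1 - z p.2 + hvar)

/-- `R(z_I) = ∏_{1≤a<b≤N} ∏_{i∈I_a} ∏_{j∈I_b} (z_i−z_j)`. -/
def Rz {n N : ℕ} (m : Fin n → Fin N) : K n :=
  ∏ p ∈ Finset.univ.filter (fun p : Fin n × Fin n => m p.1 < m p.2),
    (z p.1 - z p.2)

/-- The basis vector `v_I` corresponding to the word `m0`. -/
def bas {n N : ℕ} (m0 : Fin n → Fin N) : VV n N :=
  fun m => if m = m0 then 1 else 0

/-- `D = ∏_{1≤i<j≤n}(z_i−z_j+h)`. -/
def Dpoly (n : ℕ) : K n :=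
  ∏ p ∈ Finset.univ.filter (fun p : Fin n × Fin n => p.1 < p.2), (z p.1 - z p.2 + hvar)

/-- `Ď = ∏_{1≤i<j≤n}(z_j−z_i+h)`. -/
def Dcheck (n : ℕ) : K n :=
  ∏ p ∈ Finset.univ.filter (fun p : Fin n × Fin n => p.1 < p.2), (z p.2 - z p.1 + hvar)

section

open Finset

variable {n N : ℕ}

lemma permK_algebraMap (σ : Equiv.Perm (Fin n)) (p : MvPolynomial (Fin n ⊕ Unit) ℂ) :
    permK σ (algebraMap _ (K n) p) =
      algebraMap _ (K n) (MvPolynomial.rename (Equiv.sumCongr σ (Equiv.refl Unit)) p) := by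
  simp [permK]

@[simp] lemma permK_z (σ : Equiv.Perm (Fin n)) (i : Fin n) : permK σ (z i) = z (σ i) := by
  simp [z, permK_algebraMap]

@[simp] lemma permK_hvar (σ : Equiv.Perm (Fin n)) : permK σ hvar = hvar := by
  simp [hvar, permK_algebraMap]

lemma permK_permK (σ τ : Equiv.Perm (Fin n)) (x : K n) :
    permK σ (permK τ x) = permK (σ * τ) x := by
  obtain ⟨p, q, -, rfl⟩ := IsFractionRing.div_surjective (A := MvPolynomial (Fin n ⊕ Unit) ℂ) x
  simp only [map_div₀, permK_algebraMap, MvPolynomial.rename_rename]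
  have : (⇑(Equiv.sumCongr σ (Equiv.refl Unit)) ∘ ⇑(Equiv.sumCongr τ (Equiv.refl Unit))) =
      ⇑(Equiv.sumCongr (σ * τ) (Equiv.refl Unit)) := by
    ext x; rcases x with x | x <;> simp
  rw [this]

lemma permK_swap_swap (a b : Fin n) (x : K n) :
    permK (Equiv.swap a b) (permK (Equiv.swap a b) x) = x := by
  rw [permK_permK, Equiv.swap_mul_self]
  obtain ⟨p, q, -, rfl⟩ := IsFractionRing.div_surjective (A := MvPolynomial (Fin n ⊕ Unit) ℂ) x
  simp only [map_div₀, permK_algebraMap]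
  have : (⇑(Equiv.sumCongr (1 : Equiv.Perm (Fin n)) (Equiv.refl Unit))) = id := by
    ext x; rcases x with x | x <;> simp
  rw [this]; simp

lemma algebraMap_ne_zero_of_eval (p : MvPolynomial (Fin n ⊕ Unit) ℂ) (x : Fin n ⊕ Unit → ℂ)
    (h : MvPolynomial.eval x p ≠ 0) : algebraMap _ (K n) p ≠ 0 := by
  intro h0
  have := (IsFractionRing.injective (MvPolynomial (Fin n ⊕ Unit) ℂ) (K n)) (h0.trans (map_zero _).symm)
  exact h (by simp [this])

lemma z_sub_z_add_hvar_ne_zero (a b : Fin n) : (z a - z b + hvar : K n) ≠ 0 := by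
  have := algebraMap_ne_zero_of_eval (n := n)
    (MvPolynomial.X (Sum.inl a) - MvPolynomial.X (Sum.inl b) + MvPolynomial.X (Sum.inr ()))
    (Sum.elim 0 1) (by simp)
  simpa [z, hvar] using this

lemma z_sub_z_sub_hvar_ne_zero (a b : Fin n) : (z a - z b - hvar : K n) ≠ 0 := by
  have := z_sub_z_add_hvar_ne_zero b a
  contrapose! this
  linear_combination -this

lemma z_sub_z_ne_zero {a b : Fin n} (hab : a ≠ b) : (z a - z b : K n) ≠ 0 := by
  have := algebraMap_ne_zero_of_eval (n := n)
    (MvPolynomial.X (Sum.inl a) - MvPolynomial.X (Sum.inl b))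
    (Sum.elim (Pi.single a 1) 1) (by simp [hab.symm])
  simpa [z] using this

/-- The operator `ŝ̃^+` attached to an arbitrary pair of positions `a`, `b`. -/
def swapOp (a b : Fin n) (f : VV n N) : VV n N := fun m =>
  ((z a - z b) * permK (Equiv.swap a b) (f (m ∘ ⇑(Equiv.swap a b)))
    - hvar * permK (Equiv.swap a b) (f m)) / (z a - z b - hvar)

lemma tOp_true (i : ℕ) (hi : i + 1 < n) (f : VV n N) :
    tOp true i hi f = swapOp (fin1 i hi) (fin2 i hi) f := by
  rfl

lemma comp_swap_swap (m : Fin n → Fin N) (a b : Fin n) :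
    (m ∘ ⇑(Equiv.swap a b)) ∘ ⇑(Equiv.swap a b) = m := by
  ext x; simp

lemma swapOp_swapOp (a b : Fin n) (f : VV n N) : swapOp a b (swapOp a b f) = f := by
  ext m
  simp only [swapOp, comp_swap_swap, map_div₀, map_sub, map_mul, permK_z, permK_hvar,
    permK_swap_swap, Equiv.swap_apply_left, Equiv.swap_apply_right]
  have h1 := z_sub_z_sub_hvar_ne_zero a b
  have h2 := z_sub_z_sub_hvar_ne_zero b a
  field_simp
  ring

lemma swapOp_comm {a b c d : Fin n} (hac : a ≠ c) (had : a ≠ d) (hbc : b ≠ c) (hbd : b ≠ d)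
    (f : VV n N) : swapOp a b (swapOp c d f) = swapOp c d (swapOp a b f) := by
  have hs : Equiv.swap c d * Equiv.swap a b = Equiv.swap a b * Equiv.swap c d := by
    ext x; simp [Equiv.swap_apply_def]; grind
  have hc (m : Fin n → Fin N) : (m ∘ ⇑(Equiv.swap c d)) ∘ ⇑(Equiv.swap a b) =
      (m ∘ ⇑(Equiv.swap a b)) ∘ ⇑(Equiv.swap c d) := by
    ext x; exact congrArg (fun σ : Equiv.Perm (Fin n) => (m (σ x) : ℕ)) hs
  ext m
  simp only [swapOp, map_div₀, map_sub, map_mul, permK_z, permK_hvar, permK_permK, hs, hc,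
    Equiv.swap_apply_of_ne_of_ne hac had, Equiv.swap_apply_of_ne_of_ne hbc hbd,
    Equiv.swap_apply_of_ne_of_ne hac.symm hbc.symm, Equiv.swap_apply_of_ne_of_ne had.symm hbd.symm]
  have h1 := z_sub_z_sub_hvar_ne_zero a b
  have h2 := z_sub_z_sub_hvar_ne_zero c d
  field_simp
  ring

lemma swapOp_braid {a b c : Fin n} (hab : a ≠ b) (hac : a ≠ c) (hbc : b ≠ c)
    (f : VV n N) :
    swapOp a b (swapOp b c (swapOp a b f)) = swapOp b c (swapOp a b (swapOp b c f)) := by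
  have hs : Equiv.swap b c * (Equiv.swap a b * Equiv.swap b c) =
      Equiv.swap a b * (Equiv.swap b c * Equiv.swap a b) := by
    ext x; simp [Equiv.swap_apply_def]; grind
  have hc (m : Fin n → Fin N) :
      ((m ∘ ⇑(Equiv.swap b c)) ∘ ⇑(Equiv.swap a b)) ∘ ⇑(Equiv.swap b c) =
      ((m ∘ ⇑(Equiv.swap a b)) ∘ ⇑(Equiv.swap b c)) ∘ ⇑(Equiv.swap a b) := by
    ext x; exact congrArg (fun σ : Equiv.Perm (Fin n) => (m (σ x) : ℕ)) hs
  ext m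
  simp only [swapOp, map_div₀, map_sub, map_mul, permK_z, permK_hvar, permK_permK, hs, hc,
    comp_swap_swap,
    Equiv.swap_apply_left, Equiv.swap_apply_right,
    Equiv.swap_apply_of_ne_of_ne hab hac, Equiv.swap_apply_of_ne_of_ne hac.symm hbc.symm]
  generalize permK (Equiv.swap a b * (Equiv.swap b c * Equiv.swap a b)) = ρ
  have h1 := z_sub_z_sub_hvar_ne_zero a b
  have h2 := z_sub_z_sub_hvar_ne_zero b c
  have h3 := z_sub_z_sub_hvar_ne_zero a c
  field_simp
  ring

lemma swapOp_bas {a b : Fin n} {m : Fin n → Fin N} (hm : m a = m b) :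
    swapOp a b (bas m) = bas m := by
  have hs : m ∘ ⇑(Equiv.swap a b) = m := by
    ext x; simp [Equiv.swap_apply_def]; grind
  have hiff (m' : Fin n → Fin N) : m' ∘ ⇑(Equiv.swap a b) = m ↔ m' = m :=
    ⟨fun h => by rw [← comp_swap_swap m' a b, h, hs], fun h => by rw [h, hs]⟩
  ext m'
  have h1 := z_sub_z_sub_hvar_ne_zero a b
  by_cases h : m' = m <;> simp [swapOp, bas, hiff, h, h1]

/-- The inversions of a word. -/
def inv (m : Fin n → Fin N) : Finset (Fin n × Fin n) :=
  univ.filter fun p => p.1 < p.2 ∧ m p.2 < m p.1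

lemma mem_inv {m : Fin n → Fin N} {p : Fin n × Fin n} :
    p ∈ inv m ↔ p.1 < p.2 ∧ m p.2 < m p.1 := by
  simp [inv]

lemma inv_of_descent {a b : Fin n} (hab : a.val + 1 = b.val) {m : Fin n → Fin N}
    (hm : m b < m a) :
    inv m = insert (a, b) ((inv (m ∘ ⇑(Equiv.swap a b))).map
      (Equiv.prodCongr (Equiv.swap a b) (Equiv.swap a b)).toEmbedding) := by
  ext ⟨x, y⟩
  rw [mem_insert, mem_map_equiv, mem_inv, mem_inv]
  simp only [Prod.mk.injEq, Equiv.prodCongr_symm, Equiv.symm_swap, Equiv.prodCongr_apply,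
    Prod.map_apply, Function.comp_apply, Equiv.swap_apply_self]
  simp only [Equiv.swap_apply_def]
  grind

lemma notMem_inv_swap {a b : Fin n} (hab : a.val + 1 = b.val) (m : Fin n → Fin N) :
    (a, b) ∉ (inv (m ∘ ⇑(Equiv.swap a b))).map
      (Equiv.prodCongr (Equiv.swap a b) (Equiv.swap a b)).toEmbedding := by
  rw [mem_map_equiv, mem_inv]
  simp only [Equiv.prodCongr_symm, Equiv.symm_swap, Equiv.prodCongr_apply, Prod.map_apply,
    Equiv.swap_apply_left, Equiv.swap_apply_right]
  omega

lemma card_inv_of_descent {a b : Fin n} (hab : a.val + 1 = b.val) {m : Fin n → Fin N}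
    (hm : m b < m a) : #(inv m) = #(inv (m ∘ ⇑(Equiv.swap a b))) + 1 := by
  rw [inv_of_descent hab hm, card_insert_of_notMem (notMem_inv_swap hab m), card_map]

lemma prod_inv_of_descent {a b : Fin n} (hab : a.val + 1 = b.val) {m : Fin n → Fin N}
    (hm : m b < m a) (g : Fin n × Fin n → K n)
    (hg : ∀ x y, permK (Equiv.swap a b) (g (x, y)) = g (Equiv.swap a b x, Equiv.swap a b y)) :
    ∏ p ∈ inv m, g p =
      g (a, b) * permK (Equiv.swap a b) (∏ p ∈ inv (m ∘ ⇑(Equiv.swap a b)), g p) := by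
  rw [inv_of_descent hab hm, prod_insert (notMem_inv_swap hab m), prod_map, map_prod]
  congr 1
  exact prod_congr rfl fun p _ => (hg p.1 p.2).symm

open Classical in
/-- The vectors `ξ_I^+`, built from the monotone words by removing one inversion at a time. -/
def xi (m : Fin n → Fin N) : VV n N :=
  if h : ∃ p : Fin n × Fin n, p.1.val + 1 = p.2.val ∧ m p.2 < m p.1 then
    swapOp h.choose.1 h.choose.2 (xi (m ∘ ⇑(Equiv.swap h.choose.1 h.choose.2)))
  else bas m
termination_by #(inv m)
decreasing_by
  rw [card_inv_of_descent h.choose_spec.1 h.choose_spec.2]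
  exact Nat.lt_succ_self _

lemma exists_xi_eq {m : Fin n → Fin N}
    (h : ∃ p : Fin n × Fin n, p.1.val + 1 = p.2.val ∧ m p.2 < m p.1) :
    ∃ a b : Fin n, a.val + 1 = b.val ∧ m b < m a ∧
      xi m = swapOp a b (xi (m ∘ ⇑(Equiv.swap a b))) := by
  refine ⟨h.choose.1, h.choose.2, h.choose_spec.1, h.choose_spec.2, ?_⟩
  rw [xi, dif_pos h]

lemma xi_eq_bas {m : Fin n → Fin N}
    (h : ¬ ∃ p : Fin n × Fin n, p.1.val + 1 = p.2.val ∧ m p.2 < m p.1) :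
    xi m = bas m := by
  rw [xi, dif_neg h]

/-- Compatibility of `xi` with the operators at the descents and the plateaus of a word. -/
def XiCompat (m : Fin n → Fin N) : Prop :=
  (∀ a b : Fin n, a.val + 1 = b.val → m b < m a →
    xi m = swapOp a b (xi (m ∘ ⇑(Equiv.swap a b)))) ∧
  ∀ a b : Fin n, a.val + 1 = b.val → m a = m b → swapOp a b (xi m) = xi m

lemma swapOp_xi_eq_of_lt {m : Fin n → Fin N}
    (ih : ∀ m' : Fin n → Fin N, #(inv m') < #(inv m) → XiCompat m')
    {a b c d : Fin n} (hab : a.val + 1 = b.val) (hcd : c.val + 1 = d.val)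
    (h1 : m b < m a) (h2 : m d < m c) (hac : a < c) :
    swapOp a b (xi (m ∘ ⇑(Equiv.swap a b))) = swapOp c d (xi (m ∘ ⇑(Equiv.swap c d))) := by
  have e1 := card_inv_of_descent hab h1
  have e2 := card_inv_of_descent hcd h2
  rcases eq_or_ne b c with rfl | hbc
  · have nab : a ≠ b := by omega
    have nad : a ≠ d := by omega
    have nbd : b ≠ d := by omega
    have f1 : (m ∘ ⇑(Equiv.swap a b)) d < (m ∘ ⇑(Equiv.swap a b)) b := by
      simp [Equiv.swap_apply_of_ne_of_ne nad.symm nbd.symm, h2.trans h1]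
    have f2 : (m ∘ ⇑(Equiv.swap b d)) b < (m ∘ ⇑(Equiv.swap b d)) a := by
      simp [Equiv.swap_apply_of_ne_of_ne nab nad, h2.trans h1]
    have e3 := card_inv_of_descent hcd f1
    have e4 := card_inv_of_descent hab f2
    have f3 : ((m ∘ ⇑(Equiv.swap a b)) ∘ ⇑(Equiv.swap b d)) b <
        ((m ∘ ⇑(Equiv.swap a b)) ∘ ⇑(Equiv.swap b d)) a := by
      simp [Equiv.swap_apply_of_ne_of_ne nab nad, Equiv.swap_apply_of_ne_of_ne nad.symm nbd.symm,
        h2]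
    have f4 : ((m ∘ ⇑(Equiv.swap b d)) ∘ ⇑(Equiv.swap a b)) d <
        ((m ∘ ⇑(Equiv.swap b d)) ∘ ⇑(Equiv.swap a b)) b := by
      simp [Equiv.swap_apply_of_ne_of_ne nab nad, Equiv.swap_apply_of_ne_of_ne nad.symm nbd.symm,
        h1]
    rw [(ih _ (by omega)).1 b d hcd f1, (ih _ (by omega)).1 a b hab f3,
      (ih (m ∘ ⇑(Equiv.swap b d)) (by omega)).1 a b hab f2, (ih _ (by omega)).1 b d hcd f4,
      swapOp_braid nab nad nbd]
    congr 4
    have hs : Equiv.swap a b * (Equiv.swap b d * Equiv.swap a b) =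
        Equiv.swap b d * (Equiv.swap a b * Equiv.swap b d) := by
      ext x; simp [Equiv.swap_apply_def]; grind
    ext x; exact congrArg (fun σ : Equiv.Perm (Fin n) => (m (σ x) : ℕ)) hs
  · have nac : a ≠ c := by omega
    have nad : a ≠ d := by omega
    have nbd : b ≠ d := by omega
    have f1 : (m ∘ ⇑(Equiv.swap a b)) d < (m ∘ ⇑(Equiv.swap a b)) c := by
      simp [Equiv.swap_apply_of_ne_of_ne nad.symm nbd.symm,
        Equiv.swap_apply_of_ne_of_ne nac.symm hbc.symm, h2]
    have f2 : (m ∘ ⇑(Equiv.swap c d)) b < (m ∘ ⇑(Equiv.swap c d)) a := by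
      simp [Equiv.swap_apply_of_ne_of_ne nac nad, Equiv.swap_apply_of_ne_of_ne hbc nbd, h1]
    rw [(ih _ (by omega)).1 c d hcd f1, (ih (m ∘ ⇑(Equiv.swap c d)) (by omega)).1 a b hab f2,
      swapOp_comm nac nad hbc nbd]
    congr 3
    have hs : Equiv.swap a b * Equiv.swap c d = Equiv.swap c d * Equiv.swap a b := by
      ext x; simp [Equiv.swap_apply_def]; grind
    ext x; exact congrArg (fun σ : Equiv.Perm (Fin n) => (m (σ x) : ℕ)) hs

lemma swapOp_xi_of_plateau {m : Fin n → Fin N}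
    (ih : ∀ m' : Fin n → Fin N, #(inv m') < #(inv m) → XiCompat m')
    {a b c d : Fin n} (hab : a.val + 1 = b.val) (hcd : c.val + 1 = d.val)
    (h1 : m a = m b) (h2 : m d < m c) :
    swapOp a b (swapOp c d (xi (m ∘ ⇑(Equiv.swap c d)))) =
      swapOp c d (xi (m ∘ ⇑(Equiv.swap c d))) := by
  have e2 := card_inv_of_descent hcd h2
  have nab : a ≠ b := by omega
  have ncd : c ≠ d := by omega
  have nac : a ≠ c := by
    rintro rfl
    obtain rfl : b = d := by omega
    exact h2.ne h1.symm
  have nbd : b ≠ d := by rintro rfl; exact nac (by omega)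
  rcases eq_or_ne b c with rfl | hbc
  · have nad : a ≠ d := by omega
    have f2 : (m ∘ ⇑(Equiv.swap b d)) b < (m ∘ ⇑(Equiv.swap b d)) a := by
      simp [Equiv.swap_apply_of_ne_of_ne nab nad, h1, h2]
    have e3 := card_inv_of_descent hab f2
    have f3 : ((m ∘ ⇑(Equiv.swap b d)) ∘ ⇑(Equiv.swap a b)) b =
        ((m ∘ ⇑(Equiv.swap b d)) ∘ ⇑(Equiv.swap a b)) d := by
      simp [Equiv.swap_apply_of_ne_of_ne nab nad, Equiv.swap_apply_of_ne_of_ne nad.symm nbd.symm,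
        h1]
    rw [(ih _ (by omega)).1 a b hab f2, swapOp_braid nab nad nbd,
      (ih _ (by omega)).2 b d hcd f3]
  rcases eq_or_ne a d with rfl | nad
  · have f2 : (m ∘ ⇑(Equiv.swap c a)) b < (m ∘ ⇑(Equiv.swap c a)) a := by
      simp [Equiv.swap_apply_of_ne_of_ne hbc nbd, ← h1, h2]
    have e3 := card_inv_of_descent hab f2
    have f3 : ((m ∘ ⇑(Equiv.swap c a)) ∘ ⇑(Equiv.swap a b)) c =
        ((m ∘ ⇑(Equiv.swap c a)) ∘ ⇑(Equiv.swap a b)) a := by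
      simp [Equiv.swap_apply_of_ne_of_ne hbc nbd, Equiv.swap_apply_of_ne_of_ne nac.symm hbc.symm,
        h1]
    rw [(ih _ (by omega)).1 a b hab f2, ← swapOp_braid ncd hbc.symm nab,
      (ih _ (by omega)).2 c a hcd f3]
  · have f2 : (m ∘ ⇑(Equiv.swap c d)) a = (m ∘ ⇑(Equiv.swap c d)) b := by
      simp [Equiv.swap_apply_of_ne_of_ne nac nad, Equiv.swap_apply_of_ne_of_ne hbc nbd, h1]
    rw [swapOp_comm nac nad hbc nbd, (ih _ (by omega)).2 a b hab f2]

lemma xiCompat (m : Fin n → Fin N) : XiCompat m := by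
  induction hk : #(inv m) using Nat.strong_induction_on generalizing m with
  | _ k ih =>
    have ih' (m' : Fin n → Fin N) (h : #(inv m') < #(inv m)) : XiCompat m' :=
      ih _ (hk ▸ h) m' rfl
    constructor
    · intro a b hab h
      obtain ⟨c, d, hcd, h', e⟩ := exists_xi_eq ⟨(a, b), hab, h⟩
      rw [e]
      rcases lt_trichotomy a c with hac | rfl | hac
      · exact (swapOp_xi_eq_of_lt ih' hab hcd h h' hac).symm
      · obtain rfl : b = d := by omega
        rfl
      · exact swapOp_xi_eq_of_lt ih' hcd hab h' h hac
    · intro a b hab h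
      by_cases hd : ∃ p : Fin n × Fin n, p.1.val + 1 = p.2.val ∧ m p.2 < m p.1
      · obtain ⟨c, d, hcd, h', e⟩ := exists_xi_eq hd
        rw [e]
        exact swapOp_xi_of_plateau ih' hab hcd h h'
      · rw [xi_eq_bas hd, swapOp_bas h]

lemma xi_swap (m : Fin n → Fin N) {a b : Fin n} (hab : a.val + 1 = b.val) :
    xi (m ∘ ⇑(Equiv.swap a b)) = swapOp a b (xi m) := by
  rcases lt_trichotomy (m a) (m b) with h | h | h
  · rw [(xiCompat (m ∘ ⇑(Equiv.swap a b))).1 a b hab (by simpa using h), comp_swap_swap]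
  · rw [(xiCompat m).2 a b hab h]
    congr 1
    ext x; simp [Equiv.swap_apply_def]; grind
  · rw [(xiCompat m).1 a b hab h, swapOp_swapOp]

lemma card_filter_lt {k : ℕ} {A : Finset (Fin n)} (e : Fin k ≃o A) (t : ℕ) :
    #{x ∈ A | x.val < t} = #{j : Fin k | (e j : Fin n).val < t} := by
  symm
  refine card_bij (fun j _ => (e j : Fin n)) (fun j hj => ?_) (fun i _ j _ h => ?_) fun x hx => ?_
  · simpa using hj
  · exact e.injective (Subtype.ext h)
  · rw [mem_filter] at hx
    exact ⟨e.symm ⟨x, hx.1⟩, by simpa using hx.2, by simp⟩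

lemma subLE_iff {A B : Finset (Fin n)} :
    subLE A B ↔ #A = #B ∧ ∀ t : ℕ, #{x ∈ B | x.val < t} ≤ #{x ∈ A | x.val < t} := by
  constructor
  · rintro ⟨h, hle⟩
    refine ⟨h, fun t => ?_⟩
    rw [card_filter_lt (A.orderIsoOfFin rfl), card_filter_lt (B.orderIsoOfFin h.symm)]
    refine card_le_card fun j hj => ?_
    rw [mem_filter] at hj ⊢
    exact ⟨hj.1, lt_of_le_of_lt (hle j) hj.2⟩
  · rintro ⟨h, hle⟩
    refine ⟨h, fun j => ?_⟩
    by_contra! hlt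
    set e := A.orderIsoOfFin rfl
    set e' := B.orderIsoOfFin h.symm
    have h1 := hle ((e' j : Fin n).val + 1)
    rw [card_filter_lt e, card_filter_lt e'] at h1
    have h2 : #(Iic j) ≤ #{i | (e' i : Fin n).val < (e' j : Fin n).val + 1} := by
      refine card_le_card fun i hi => ?_
      rw [mem_filter]
      exact ⟨mem_univ _, Nat.lt_succ_of_le (e'.monotone (mem_Iic.1 hi))⟩
    have h3 : #{i | (e i : Fin n).val < (e' j : Fin n).val + 1} ≤ #(Iio j) := by
      refine card_le_card fun i hi => ?_
      rw [mem_filter] at hi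
      rw [mem_Iio, ← e.lt_iff_lt]
      exact Subtype.coe_lt_coe.1 (lt_of_le_of_lt (Fin.le_def.2 (Nat.le_of_lt_succ hi.2)) hlt)
    rw [Fin.card_Iic] at h2
    rw [Fin.card_Iio] at h3
    omega

lemma card_filter_lt_succ (A : Finset (Fin n)) (k : Fin n) :
    #{x ∈ A | x.val < k.val + 1} = #{x ∈ A | x.val < k.val} + if k ∈ A then 1 else 0 := by
  split_ifs with h
  · rw [← card_insert_of_notMem (a := k) (by simp)]
    congr 1
    ext x
    simp only [mem_filter, mem_insert]
    grind
  · congr 1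
    ext x
    simp only [mem_filter]
    grind

lemma subLE_antisymm {A B : Finset (Fin n)} (h1 : subLE A B) (h2 : subLE B A) : A = B := by
  rw [subLE_iff] at h1 h2
  have h t := le_antisymm (h1.2 t) (h2.2 t)
  ext k
  have := card_filter_lt_succ A k
  rw [← h, ← h, card_filter_lt_succ B k] at this
  split_ifs at this <;> simp_all

lemma subLE_trans {A B C : Finset (Fin n)} (h1 : subLE A B) (h2 : subLE B C) : subLE A C := by
  rw [subLE_iff] at *
  exact ⟨h1.1.trans h2.1, fun t => (h2.2 t).trans (h1.2 t)⟩

lemma decLT_trans {u v w : Fin n → Fin N} (h1 : decLT u v) (h2 : decLT v w) : decLT u w := by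
  obtain ⟨l, hl, hs, hne⟩ := h1
  obtain ⟨l', hl', hs', hne'⟩ := h2
  rcases lt_trichotomy l l' with h | rfl | h
  · exact ⟨l, fun k hk => (hl k hk).trans (hl' k (hk.trans h)), hl' l h ▸ hs, hl' l h ▸ hne⟩
  · refine ⟨l, fun k hk => (hl k hk).trans (hl' k hk), subLE_trans hs hs', fun h => hne ?_⟩
    exact subLE_antisymm hs (h ▸ hs')
  · exact ⟨l', fun k hk => (hl k (hk.trans h)).trans (hl' k hk), (hl l' h).symm ▸ hs',
      (hl l' h).symm ▸ hne'⟩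

lemma not_decLT_self (u : Fin n → Fin N) : ¬ decLT u u := by
  rintro ⟨l, -, -, h⟩
  exact h rfl

lemma decLT_of_decLE_of_decLT {u v w : Fin n → Fin N} (h1 : decLE u v) (h2 : decLT v w) :
    decLT u w := by
  rcases h1 with h1 | rfl
  · exact decLT_trans h1 h2
  · exact h2

lemma mem_fib {m : Fin n → Fin N} {l : Fin N} {k : Fin n} : k ∈ fib m l ↔ m k = l := by
  simp [fib]

lemma fib_comp (m : Fin n → Fin N) (a b : Fin n) (l : Fin N) :
    fib (m ∘ ⇑(Equiv.swap a b)) l = (fib m l).map (Equiv.swap a b).toEmbedding := by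
  ext k
  rw [mem_map_equiv, mem_fib, mem_fib, Equiv.symm_swap, Function.comp_apply]

lemma card_filter_map_swap {a b : Fin n} (hab : a.val + 1 = b.val) (A : Finset (Fin n)) {t : ℕ}
    (ht : t ≠ b.val) :
    #{x ∈ A.map (Equiv.swap a b).toEmbedding | x.val < t} = #{x ∈ A | x.val < t} := by
  rw [filter_map, card_map]
  congr 1
  ext x
  simp only [mem_filter, Function.comp_apply, Equiv.coe_toEmbedding, Equiv.swap_apply_def]
  grind

lemma card_filter_map_swap_self {a b : Fin n} (hab : a.val + 1 = b.val) (A : Finset (Fin n)) :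
    #{x ∈ A.map (Equiv.swap a b).toEmbedding | x.val < b.val} =
      #{x ∈ A | x.val < a.val} + if b ∈ A then 1 else 0 := by
  rw [← hab, card_filter_lt_succ, card_filter_map_swap hab A (by omega)]
  simp [mem_map_equiv]

lemma subLE_map_swap {a b : Fin n} (hab : a.val + 1 = b.val) {A B : Finset (Fin n)}
    (hAB : subLE A B) (h : b ∈ B → a ∉ A ∧ a ∉ B) :
    subLE (A.map (Equiv.swap a b).toEmbedding) (B.map (Equiv.swap a b).toEmbedding) := by
  rw [subLE_iff] at hAB ⊢
  refine ⟨by simpa using hAB.1, fun t => ?_⟩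
  rcases eq_or_ne t b.val with rfl | ht
  · rw [card_filter_map_swap_self hab, card_filter_map_swap_self hab]
    have h0 := hAB.2 a.val
    have h1 := hAB.2 (b.val + 1)
    rw [card_filter_lt_succ, card_filter_lt_succ, ← hab, card_filter_lt_succ,
      card_filter_lt_succ] at h1
    grind
  · rw [card_filter_map_swap hab A ht, card_filter_map_swap hab B ht]
    exact hAB.2 t

lemma decLT_swap {a b : Fin n} (hab : a.val + 1 = b.val) {v : Fin n → Fin N} (h : v a < v b) :
    decLT v (v ∘ ⇑(Equiv.swap a b)) := by
  refine ⟨v a, fun k hk => ?_, ?_, fun he => ?_⟩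
  · ext x
    simp only [mem_fib, Function.comp_apply, Equiv.swap_apply_def]
    grind
  · rw [fib_comp, subLE_iff]
    refine ⟨by simp, fun t => ?_⟩
    rcases eq_or_ne t b.val with rfl | ht
    · rw [card_filter_map_swap_self hab, if_neg (by simpa [mem_fib] using h.ne'), ← hab,
        card_filter_lt_succ]
      omega
    · rw [card_filter_map_swap hab _ ht]
  · have : a ∈ fib (v ∘ ⇑(Equiv.swap a b)) (v a) := he ▸ mem_fib.2 rfl
    rw [mem_fib] at this
    simp [h.ne'] at this

lemma decLE_comp_swap {a b : Fin n} (hab : a.val + 1 = b.val) {u v : Fin n → Fin N}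
    (h : v a < v b) (huv : decLE u v) :
    decLE (u ∘ ⇑(Equiv.swap a b)) (v ∘ ⇑(Equiv.swap a b)) := by
  rcases huv with ⟨l, hl, hs, hne⟩ | rfl
  · refine Or.inl ⟨l, fun k hk => ?_, ?_, ?_⟩
    · rw [fib_comp, fib_comp, hl k hk]
    · rw [fib_comp, fib_comp]
      refine subLE_map_swap hab hs fun hb => ?_
      obtain rfl := mem_fib.1 hb
      have ha : a ∈ fib u (v a) := hl _ h ▸ mem_fib.2 rfl
      rw [mem_fib] at ha
      simp [mem_fib, ha, h.ne]
    · rw [fib_comp, fib_comp]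
      exact fun he => hne (map_injective _ he)
  · exact Or.inr rfl

/-- Induction on words: sort by adjacent transpositions, one descent at a time. -/
lemma word_induction {P : (Fin n → Fin N) → Prop} (hmono : ∀ m, Monotone m → P m)
    (hstep : ∀ (m : Fin n → Fin N) (a b : Fin n), a.val + 1 = b.val → m b < m a →
      P (m ∘ ⇑(Equiv.swap a b)) → P m) (m : Fin n → Fin N) : P m := by
  induction hk : #(inv m) using Nat.strong_induction_on generalizing m with
  | _ k ih =>
    by_cases hd : ∃ a b : Fin n, a.val + 1 = b.val ∧ m b < m a
    · obtain ⟨a, b, hab, h⟩ := hd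
      have := card_inv_of_descent hab h
      exact hstep m a b hab h (ih _ (by omega) _ rfl)
    · push Not at hd
      refine hmono m ?_
      cases n with
      | zero => exact Subsingleton.monotone m
      | succ n => exact Fin.monotone_iff_le_succ.2 fun i => hd _ _ (by simp)

lemma xi_of_monotone {m : Fin n → Fin N} (hm : Monotone m) : xi m = bas m := by
  refine xi_eq_bas ?_
  rintro ⟨p, hp, h⟩
  exact h.not_ge (hm (Fin.le_def.2 (by omega)))

lemma inv_of_monotone {m : Fin n → Fin N} (hm : Monotone m) : inv m = ∅ := by
  ext p
  rw [mem_inv]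
  simpa using fun h : p.1 < p.2 => hm h.le

lemma xi_of_descent {m : Fin n → Fin N} {a b : Fin n} (hab : a.val + 1 = b.val) (h : m b < m a) :
    xi m = swapOp a b (xi (m ∘ ⇑(Equiv.swap a b))) :=
  (xiCompat m).1 a b hab h

lemma decLE_of_xi_ne_zero (m : Fin n → Fin N) :
    ∀ m', xi m m' ≠ 0 → decLE m' m ∧ ∀ l, #(fib m' l) = #(fib m l) := by
  induction m using word_induction with
  | hmono m hm =>
    intro m' h
    obtain rfl : m' = m := by
      by_contra hne
      simp [xi_of_monotone hm, bas, hne] at h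
    exact ⟨Or.inr rfl, fun _ => rfl⟩
  | hstep m a b hab h ih =>
    intro m' hne
    set v := m ∘ ⇑(Equiv.swap a b) with hv
    have hmv : m = v ∘ ⇑(Equiv.swap a b) := (comp_swap_swap m a b).symm
    have hlt : v a < v b := by simpa [hv] using h
    have hcard (u : Fin n → Fin N) (l : Fin N) :
        #(fib (u ∘ ⇑(Equiv.swap a b)) l) = #(fib u l) := by rw [fib_comp, card_map]
    by_cases h1 : xi v m' = 0
    · have h2 : xi v (m' ∘ ⇑(Equiv.swap a b)) ≠ 0 := by
        intro h2
        rw [xi_of_descent hab h] at hne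
        simp [swapOp, ← hv, h1, h2] at hne
      obtain ⟨hle, hc⟩ := ih _ h2
      have := decLE_comp_swap hab hlt hle
      rw [comp_swap_swap, ← hmv] at this
      exact ⟨this, fun l => by rw [← hcard m' l, hc l, hcard]⟩
    · obtain ⟨hle, hc⟩ := ih _ h1
      refine ⟨Or.inl (decLT_of_decLE_of_decLT hle ?_), fun l => by rw [hc l, hcard]⟩
      rw [hmv]
      exact decLT_swap hab hlt

lemma xi_self (m : Fin n → Fin N) :
    xi m m = (∏ p ∈ inv m, (z p.2 - z p.1)) / ∏ p ∈ inv m, (z p.2 - z p.1 + hvar) := by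
  induction m using word_induction with
  | hmono m hm => simp [xi_of_monotone hm, inv_of_monotone hm, bas]
  | hstep m a b hab h ih =>
    have h0 : xi (m ∘ ⇑(Equiv.swap a b)) m = 0 := by
      by_contra hne
      have h1 := (decLE_of_xi_ne_zero _ _ hne).1
      have h2 : decLT (m ∘ ⇑(Equiv.swap a b)) m := by
        simpa [comp_swap_swap] using
          decLT_swap hab (v := m ∘ ⇑(Equiv.swap a b)) (by simpa using h)
      exact not_decLT_self _ (decLT_of_decLE_of_decLT h1 h2)
    rw [xi_of_descent hab h, prod_inv_of_descent hab h _ (by simp),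
      prod_inv_of_descent hab h _ (by simp), mul_div_mul_comm, ← map_div₀, ← ih, swapOp, h0]
    have h1 := z_sub_z_sub_hvar_ne_zero a b
    have h2 := z_sub_z_add_hvar_ne_zero b a
    simp only [map_zero]
    field_simp
    ring

lemma permK_mem_range (σ : Equiv.Perm (Fin n)) {x : K n}
    (hx : x ∈ (algebraMap (MvPolynomial (Fin n ⊕ Unit) ℂ) (K n)).range) :
    permK σ x ∈ (algebraMap (MvPolynomial (Fin n ⊕ Unit) ℂ) (K n)).range := by
  obtain ⟨p, rfl⟩ := hx
  exact ⟨_, (permK_algebraMap σ p).symm⟩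

lemma z_mem_range (i : Fin n) :
    (z i : K n) ∈ (algebraMap (MvPolynomial (Fin n ⊕ Unit) ℂ) (K n)).range := ⟨_, rfl⟩

lemma hvar_mem_range :
    (hvar : K n) ∈ (algebraMap (MvPolynomial (Fin n ⊕ Unit) ℂ) (K n)).range := ⟨_, rfl⟩

lemma xi_mul_prod_mem_range (m : Fin n → Fin N) :
    ∀ m', xi m m' * ∏ p ∈ inv m, (z p.2 - z p.1 + hvar) ∈
      (algebraMap (MvPolynomial (Fin n ⊕ Unit) ℂ) (K n)).range := by
  induction m using word_induction with
  | hmono m hm =>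
    intro m'
    rw [xi_of_monotone hm, inv_of_monotone hm, prod_empty, mul_one, bas]
    split_ifs
    exacts [one_mem _, zero_mem _]
  | hstep m a b hab h ih =>
    intro m'
    have e : xi m m' * ∏ p ∈ inv m, (z p.2 - z p.1 + hvar) =
        hvar * permK (Equiv.swap a b) (xi (m ∘ ⇑(Equiv.swap a b)) m' *
          ∏ p ∈ inv (m ∘ ⇑(Equiv.swap a b)), (z p.2 - z p.1 + hvar)) -
        (z a - z b) * permK (Equiv.swap a b)
          (xi (m ∘ ⇑(Equiv.swap a b)) (m' ∘ ⇑(Equiv.swap a b)) *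
          ∏ p ∈ inv (m ∘ ⇑(Equiv.swap a b)), (z p.2 - z p.1 + hvar)) := by
      rw [xi_of_descent hab h, prod_inv_of_descent hab h _ (by simp), swapOp, map_mul, map_mul]
      have h1 := z_sub_z_sub_hvar_ne_zero a b
      field_simp
      ring
    rw [e]
    exact sub_mem (mul_mem hvar_mem_range (permK_mem_range _ (ih _)))
      (mul_mem (sub_mem (z_mem_range _) (z_mem_range _)) (permK_mem_range _ (ih _)))

lemma exists_xi_eq_div_Dcheck (m m' : Fin n → Fin N) :
    ∃ (p : MvPolynomial (Fin n ⊕ Unit) ℂ) (k : ℕ),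
      xi m m' = algebraMap (MvPolynomial (Fin n ⊕ Unit) ℂ) (K n) p / Dcheck n ^ k := by
  have hsub : inv m ⊆ univ.filter fun p : Fin n × Fin n => p.1 < p.2 :=
    fun p hp => by simpa using (mem_inv.1 hp).1
  have h1 : ∏ p ∈ (univ.filter fun p : Fin n × Fin n => p.1 < p.2) \ inv m,
      (z p.2 - z p.1 + hvar) ∈ (algebraMap (MvPolynomial (Fin n ⊕ Unit) ℂ) (K n)).range :=
    prod_mem fun p _ => add_mem (sub_mem (z_mem_range _) (z_mem_range _)) hvar_mem_range
  obtain ⟨p, hp⟩ := mul_mem h1 (xi_mul_prod_mem_range m m')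
  have hD : Dcheck n ≠ 0 := prod_ne_zero_iff.2 fun p _ => z_sub_z_add_hvar_ne_zero _ _
  refine ⟨p, 1, ?_⟩
  rw [hp, pow_one, eq_div_iff hD, Dcheck, ← prod_sdiff hsub]
  ring

lemma prod_lt_of_antitone {m : Fin n → Fin N} (hm : Antitone m) (g : Fin n → Fin n → K n) :
    ∏ p ∈ univ.filter (fun p : Fin n × Fin n => m p.1 < m p.2), g p.1 p.2 =
      ∏ p ∈ inv m, g p.2 p.1 := by
  refine prod_nbij' Prod.swap Prod.swap (fun p hp => ?_) (fun p hp => ?_) (by simp) (by simp)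
    (by simp)
  · have h := (mem_filter.1 hp).2
    exact mem_inv.2 ⟨lt_of_not_ge fun hle => (hm hle).not_gt h, h⟩
  · exact mem_filter.2 ⟨mem_univ _, (mem_inv.1 hp).2⟩

lemma eq_of_monotone_of_card_fib {m m' : Fin n → Fin N} (hm : Monotone m) (hm' : Monotone m')
    (h : ∀ l, #(fib m l) = #(fib m' l)) : m = m' := by
  have e (l : Fin N) : {k // m k = l} ≃ {k // m' k = l} :=
    Fintype.equivOfCardEq (by rw [Fintype.card_subtype, Fintype.card_subtype]; exact h l)
  let σ : Equiv.Perm (Fin n) :=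
    (Equiv.sigmaFiberEquiv m).symm.trans
      ((Equiv.sigmaCongrRight e).trans (Equiv.sigmaFiberEquiv m'))
  have hσ : m = m' ∘ σ := funext fun k => ((e (m k)) ⟨k, rfl⟩).2.symm
  have := Tuple.unique_monotone (f := m') (σ := σ) (τ := 1) (hσ ▸ hm) hm'
  rw [hσ, this]
  rfl

lemma memI_comp_swap {lam : Fin N → ℕ} {m : Fin n → Fin N} (hm : memI lam m) (a b : Fin n) :
    memI lam (m ∘ ⇑(Equiv.swap a b)) := fun l => by
  rw [fib_comp, card_map, hm l]

end

/-- existence and uniqueness of the vectors `ξ_I^+`, `I ∈ ℐ_λ`, with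
`ξ^+_{I^min} = v_{I^min}` and `ξ^+_{s_i(I)} = ŝ̃_i^+ ξ^+_I`, together with the
triangularity properties.  Here `m0` encodes `I^min` (the unique monotone decomposition
in `ℐ_λ`) and `m1` encodes `I^max` (the unique antitone one). -/
theorem statement6 (n N : ℕ) (lam : Fin N → ℕ) (hlam : ∑ a : Fin N, lam a = n)
    (m0 : Fin n → Fin N) (hm0 : memI lam m0) (hm0mono : Monotone m0)
    (m1 : Fin n → Fin N) (hm1 : memI lam m1) (hm1anti : Antitone m1) :
    ∃ ξ : (Fin n → Fin N) → VV n N,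
      -- defining properties
      (ξ m0 = bas m0) ∧
      (∀ m, memI lam m → ∀ (i : ℕ) (hi : i + 1 < n),
        ξ (m ∘ ⇑(Equiv.swap (fin1 i hi) (fin2 i hi))) = tOp true i hi (ξ m)) ∧
      -- uniqueness (on ℐ_λ)
      (∀ ξ' : (Fin n → Fin N) → VV n N,
        ξ' m0 = bas m0 →
        (∀ m, memI lam m → ∀ (i : ℕ) (hi : i + 1 < n),
          ξ' (m ∘ ⇑(Equiv.swap (fin1 i hi) (fin2 i hi))) = tOp true i hi (ξ' m)) →
        ∀ m, memI lam m → ξ' m = ξ m) ∧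
      -- coefficients lie in ℂ[z_1,…,z_n,h][Ď⁻¹]
      (∀ m m' : Fin n → Fin N, ∃ (p : MvPolynomial (Fin n ⊕ Unit) ℂ) (k : ℕ),
        ξ m m' = algebraMap (MvPolynomial (Fin n ⊕ Unit) ℂ) (K n) p / Dcheck n ^ k) ∧
      -- triangularity: ξ^+_I = Σ_{J ≤ I} X^+_{I,J} v_J
      (∀ m, memI lam m → ∀ m' : Fin n → Fin N,
        ¬ (memI lam m' ∧ decLE m' m) → ξ m m' = 0) ∧
      -- X^+_{I,I} ≠ 0
      (∀ m, memI lam m → ξ m m ≠ 0) ∧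
      -- X^+_{I^max,I^max} = R(z_{I^max})/Q(z_{I^max})
      (ξ m1 m1 = Rz m1 / Qz m1) := by
  refine ⟨xi, xi_of_monotone hm0mono, fun m _ i hi => ?_, fun ξ' h0 hstep m hm => ?_,
    exists_xi_eq_div_Dcheck, fun m hm m' h => ?_, fun m _ => ?_, ?_⟩
  · rw [tOp_true, xi_swap m rfl]
  · induction m using word_induction with
    | hmono m hmono =>
      obtain rfl := eq_of_monotone_of_card_fib hmono hm0mono fun l => (hm l).trans (hm0 l).symm
      rw [h0, xi_of_monotone hmono]
    | hstep m a b hab h ih =>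
      have hi : a.val + 1 < n := hab ▸ b.isLt
      have ha : fin1 a.val hi = a := rfl
      have hb : fin2 a.val hi = b := Fin.ext hab
      have hm' := memI_comp_swap hm a b
      have e := hstep _ hm' a.val hi
      rw [tOp_true, ha, hb, comp_swap_swap] at e
      rw [e, ih hm', ← xi_of_descent hab h]
  · by_contra hne
    obtain ⟨hle, hc⟩ := decLE_of_xi_ne_zero m m' hne
    exact h ⟨fun l => (hc l).trans (hm l), hle⟩
  · rw [xi_self]
    exact div_ne_zero
      (Finset.prod_ne_zero_iff.2 fun p hp => z_sub_z_ne_zero (mem_inv.1 hp).1.ne')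
      (Finset.prod_ne_zero_iff.2 fun p _ => z_sub_z_add_hvar_ne_zero _ _)
  · rw [xi_self, Rz, Qz, prod_lt_of_antitone hm1anti fun x y => z x - z y,
      prod_lt_of_antitone hm1anti fun x y => z x - z y + hvar]

end GRTV
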